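/- arXiv:2106.04033 — 3 statements merged into one kernel-verified Lean document; each statement's English description precedes it below -/
import Mathlib

section
/- For any A ∈ ℤ^{m×n} with columns a_1, …, a_n and any b ∈ ℤ^m, there exists a finite collection of at most 2‖A‖_{1,1} + 2‖b‖_1 + n + 1 pairs (w, c) ∈ ℤ^m × ℤ (each defining the affine hyperplane {u ∈ ℝ^m : w·u = c}) with the following property: for all u, u′ ∈ [0,1]^m, if for every pair (w, c) in the collection one has (w·u ≥ c if and only if w·u′ ≥ c), then ⌊u·a_i⌋ = ⌊u′·a_i⌋ for every i ∈ {1, …, n} and ⌊u·b⌋ = ⌊u′·b⌋; in other words, u and u′ define the same Chvátal–Gomory cut. -/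
/-- The pairs `(a, c)` with `|c| ≤ ‖a‖₁`: the integer level sets of `u ↦ a ⬝ u` that can meet
the unit cube. -/
noncomputable def levelPairs {m : ℕ} (a : Fin m → ℤ) : Finset ((Fin m → ℤ) × ℤ) :=
  {a} ×ˢ Finset.Icc (-∑ j, |a j|) (∑ j, |a j|)

theorem card_levelPairs {m : ℕ} (a : Fin m → ℤ) :
    ((levelPairs a).card : ℤ) = 2 * (∑ j, |a j|) + 1 := by
  have h : 0 ≤ ∑ j, |a j| := Finset.sum_nonneg fun j _ => abs_nonneg _
  rw [levelPairs, Finset.card_product, Finset.card_singleton, one_mul, Int.card_Icc,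
    Int.toNat_of_nonneg (by linarith)]
  ring

theorem abs_sum_mul_le_of_mem_Icc {m : ℕ} (a : Fin m → ℤ) {u : Fin m → ℝ}
    (hu : ∀ j, u j ∈ Set.Icc (0 : ℝ) 1) :
    |∑ j, u j * (a j : ℝ)| ≤ ((∑ j, |a j| : ℤ) : ℝ) := by
  push_cast
  refine (Finset.abs_sum_le_sum_abs _ _).trans (Finset.sum_le_sum fun j _ => ?_)
  rw [abs_mul, abs_of_nonneg (hu j).1]
  exact mul_le_of_le_one_left (abs_nonneg _) (hu j).2

theorem floor_le_floor_of_levelPairs {m : ℕ} (a : Fin m → ℤ) {u u' : Fin m → ℝ}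
    (hu : ∀ j, u j ∈ Set.Icc (0 : ℝ) 1)
    (h : ∀ p ∈ levelPairs a, (p.2 : ℝ) ≤ ∑ j, (p.1 j : ℝ) * u j →
      (p.2 : ℝ) ≤ ∑ j, (p.1 j : ℝ) * u' j) :
    ⌊∑ j, u j * (a j : ℝ)⌋ ≤ ⌊∑ j, u' j * (a j : ℝ)⌋ := by
  obtain ⟨hl, hr⟩ := abs_le.mp (abs_sum_mul_le_of_mem_Icc a hu)
  have hmem : (a, ⌊∑ j, u j * (a j : ℝ)⌋) ∈ levelPairs a := by
    simp only [levelPairs, Finset.mem_product, Finset.mem_singleton, Finset.mem_Icc, true_and]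
    refine ⟨Int.le_floor.mpr ?_, Int.cast_le (R := ℝ) |>.mp ((Int.floor_le _).trans hr)⟩
    rwa [Int.cast_neg]
  have key := h _ hmem
  simp only [mul_comm (a _ : ℝ)] at key
  exact Int.le_floor.mpr (key (Int.floor_le _))

theorem floor_eq_floor_of_levelPairs {m : ℕ} (a : Fin m → ℤ) {u u' : Fin m → ℝ}
    (hu : ∀ j, u j ∈ Set.Icc (0 : ℝ) 1) (hu' : ∀ j, u' j ∈ Set.Icc (0 : ℝ) 1)
    (h : ∀ p ∈ levelPairs a, ((p.2 : ℝ) ≤ ∑ j, (p.1 j : ℝ) * u j ↔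
      (p.2 : ℝ) ≤ ∑ j, (p.1 j : ℝ) * u' j)) :
    ⌊∑ j, u j * (a j : ℝ)⌋ = ⌊∑ j, u' j * (a j : ℝ)⌋ :=
  le_antisymm (floor_le_floor_of_levelPairs a hu fun p hp => (h p hp).mp)
    (floor_le_floor_of_levelPairs a hu' fun p hp => (h p hp).mpr)


/-- **Lemma 3.2 (hyperplane partition for a single CG cut).** For any
`A ∈ ℤ^{m×n}` with columns `a₁, …, aₙ` and any `b ∈ ℤ^m`, there is a collection
of at most `2‖A‖₁,₁ + 2‖b‖₁ + n + 1` pairs `(w, c) ∈ ℤ^m × ℤ` (each defining the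
hyperplane `{u : w ⬝ u = c}`) such that any two `u, u' ∈ [0,1]^m` lying on the
same sides of all these hyperplanes define the same Chvátal–Gomory cut:
`⌊u ⬝ aᵢ⌋ = ⌊u' ⬝ aᵢ⌋` for all `i`, and `⌊u ⬝ b⌋ = ⌊u' ⬝ b⌋`. -/
theorem cg_cut_hyperplane_partition (m n : ℕ) (A : Matrix (Fin m) (Fin n) ℤ)
    (b : Fin m → ℤ) :
    ∃ H : Finset ((Fin m → ℤ) × ℤ),
      (H.card : ℤ) ≤ 2 * (∑ i, ∑ j, |A j i|) + 2 * (∑ j, |b j|) + n + 1 ∧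
      ∀ u u' : Fin m → ℝ,
        (∀ j, u j ∈ Set.Icc (0 : ℝ) 1) → (∀ j, u' j ∈ Set.Icc (0 : ℝ) 1) →
        (∀ p ∈ H, ((p.2 : ℝ) ≤ ∑ j, (p.1 j : ℝ) * u j ↔
                   (p.2 : ℝ) ≤ ∑ j, (p.1 j : ℝ) * u' j)) →
        (∀ i, ⌊∑ j, u j * (A j i : ℝ)⌋ = ⌊∑ j, u' j * (A j i : ℝ)⌋) ∧
          ⌊∑ j, u j * (b j : ℝ)⌋ = ⌊∑ j, u' j * (b j : ℝ)⌋ := by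
  classical
  refine ⟨(Finset.univ.biUnion fun i => levelPairs fun j => A j i) ∪ levelPairs b, ?_, ?_⟩
  · have hA : (((Finset.univ.biUnion fun i => levelPairs fun j => A j i).card : ℕ) : ℤ) ≤
        2 * (∑ i, ∑ j, |A j i|) + n :=
      calc _ ≤ ∑ i, ((levelPairs fun j => A j i).card : ℤ) := mod_cast Finset.card_biUnion_le
        _ = _ := by simp [card_levelPairs, Finset.sum_add_distrib, Finset.mul_sum]
    have hunion := Finset.card_union_le
      (Finset.univ.biUnion fun i => levelPairs fun j => A j i) (levelPairs b)
    have hb := card_levelPairs b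
    linarith [(Nat.cast_le (α := ℤ)).mpr hunion, Nat.cast_add (R := ℤ)
      (Finset.univ.biUnion fun i => levelPairs fun j => A j i).card (levelPairs b).card]
  · intro u u' hu hu' h
    refine ⟨fun i => floor_eq_floor_of_levelPairs (fun j => A j i) hu hu' fun p hp => h p ?_,
      floor_eq_floor_of_levelPairs b hu hu' fun p hp => h p (Finset.mem_union_right _ hp)⟩
    exact Finset.mem_union_left _ (Finset.mem_biUnion.mpr ⟨i, Finset.mem_univ i, hp⟩)
end

section
/- Fix m, n, W ∈ ℕ, A ∈ ℤ^{m×n} with columns a_1, …, a_n, and b ∈ ℤ^m. The image of the map (u_1, …, u_W) ↦ ((⌊u_w · ã^w(a_i)⌋)_{i ∈ [n], w ∈ [W]}, (⌊u_w · ã^w(b)⌋)_{w ∈ [W]}), as (u_1, …, u_W) ranges over [0,1]^m × [0,1]^{m+1} × ⋯ × [0,1]^{m+W−1}, is a finite set of cardinality at most ∏_{w=1}^W [(2^w‖b‖_1 + 1) · ∏_{i=1}^n (2^w‖a_i‖_1 + 1)]. In particular, only finitely many distinct sequences of W sequential Chvátal–Gomory cuts arise, with this explicit bound on their number. -/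
/-- The recursively augmented constraint columns: `atil m u a 0 = a`, and
`atil m u a (w+1)` appends the scalar `u_w ⬝ atil m u a w` as a new last
coordinate (zero-indexed version of `ã^{w+1}(a)`). -/
def atil (m : ℕ) (u : (w : ℕ) → Fin (m + w) → ℝ) (a : Fin m → ℝ) :
    (w : ℕ) → Fin (m + w) → ℝ
  | 0 => a
  | (w + 1) => Fin.snoc (atil m u a w) (∑ j, u w j * atil m u a w j)

/-- A dot product with weights in `[0,1]` is bounded by the `ℓ¹` norm. -/
lemma abs_sum_mul_le_sum_abs_of_mem_Icc {ι : Type*} [Fintype ι] {u v : ι → ℝ}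
    (hu : ∀ j, u j ∈ Set.Icc (0 : ℝ) 1) : |∑ j, u j * v j| ≤ ∑ j, |v j| := by
  refine (Finset.abs_sum_le_sum_abs _ _).trans (Finset.sum_le_sum fun j _ => ?_)
  rw [abs_mul, abs_of_nonneg (hu j).1]
  exact mul_le_of_le_one_left (abs_nonneg _) (hu j).2

/-- Each augmentation step at most doubles the `ℓ¹` norm. -/
lemma sum_abs_atil_le (m : ℕ) (u : (w : ℕ) → Fin (m + w) → ℝ) (a : Fin m → ℝ) (w : ℕ)
    (hu : ∀ k < w, ∀ j, u k j ∈ Set.Icc (0 : ℝ) 1) :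
    ∑ j, |atil m u a w j| ≤ 2 ^ w * ∑ j, |a j| := by
  induction w with
  | zero => simp [atil]
  | succ w ih =>
    have ih := ih fun k hk => hu k (hk.trans w.lt_succ_self)
    have hdot := abs_sum_mul_le_sum_abs_of_mem_Icc (v := atil m u a w) (hu w w.lt_succ_self)
    have hsplit : ∑ j, |atil m u a (w + 1) j| =
        ∑ j, |atil m u a w j| + |∑ j, u w j * atil m u a w j| := by
      change ∑ j : Fin (m + w + 1), |atil m u a (w + 1) j| = _
      rw [Fin.sum_univ_castSucc]
      simp [atil]
    rw [hsplit, pow_succ]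
    linarith

/-- The `w`-th cut coefficient of an integer column lies in a fixed integer interval. -/
lemma floor_sum_mul_atil_mem_Icc (m : ℕ) (u : (w : ℕ) → Fin (m + w) → ℝ) (a : Fin m → ℤ) (w : ℕ)
    (hu : ∀ k ≤ w, ∀ j, u k j ∈ Set.Icc (0 : ℝ) 1) :
    ⌊∑ j, u w j * atil m u (fun j' => (a j' : ℝ)) w j⌋ ∈
      Finset.Icc (-((2 ^ w * ∑ j, (a j).natAbs : ℕ) : ℤ)) ((2 ^ w * ∑ j, (a j).natAbs : ℕ) : ℤ) := by
  have h := abs_le.1 ((abs_sum_mul_le_sum_abs_of_mem_Icc (hu w le_rfl)).trans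
    (sum_abs_atil_le m u (fun j' => (a j' : ℝ)) w fun k hk => hu k hk.le))
  have hcast : (2 : ℝ) ^ w * ∑ j, |(a j : ℝ)| = ((2 ^ w * ∑ j, (a j).natAbs : ℕ) : ℝ) := by
    push_cast [Nat.cast_natAbs]
    rfl
  rw [hcast] at h
  rw [Finset.mem_Icc]
  constructor
  · rw [Int.le_floor]
    exact_mod_cast h.1
  · rw [← Int.cast_le (R := ℝ), Int.cast_natCast]
    exact (Int.floor_le _).trans h.2

lemma card_Icc_neg_natCast (N : ℕ) : (Finset.Icc (-(N : ℤ)) N).card = 2 * N + 1 := by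
  rw [Int.card_Icc]
  omega

/-- **Finitely many sequences of `W` sequential Chvátal–Gomory cuts.** The image
of `(u_1, …, u_W) ↦ ((⌊u_w ⬝ ã^w(aᵢ)⌋)_{i,w}, (⌊u_w ⬝ ã^w(b)⌋)_w)` over the box
`[0,1]^m × ⋯ × [0,1]^{m+W−1}` is a finite set of cardinality at most
`∏_{w=1}^W [(2^w ‖b‖₁ + 1) ⬝ ∏ᵢ (2^w ‖aᵢ‖₁ + 1)]`
(zero-indexed: `w ∈ Finset.range W` contributes factor with `2^(w+1)`). -/
theorem sequential_cg_cut_image_finite (m n W : ℕ)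
    (A : Matrix (Fin m) (Fin n) ℤ) (b : Fin m → ℤ) :
    ((fun u : (w : ℕ) → Fin (m + w) → ℝ =>
        ((fun (i : Fin n) (w : Fin W) =>
            ⌊∑ j, u w j * atil m u (fun j' => (A j' i : ℝ)) w j⌋,
          fun w : Fin W =>
            ⌊∑ j, u w j * atil m u (fun j' => (b j' : ℝ)) w j⌋) :
          (Fin n → Fin W → ℤ) × (Fin W → ℤ))) ''
        {u | ∀ w < W, ∀ j, u w j ∈ Set.Icc (0 : ℝ) 1}).Finite ∧
      Nat.card ↥((fun u : (w : ℕ) → Fin (m + w) → ℝ =>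
        ((fun (i : Fin n) (w : Fin W) =>
            ⌊∑ j, u w j * atil m u (fun j' => (A j' i : ℝ)) w j⌋,
          fun w : Fin W =>
            ⌊∑ j, u w j * atil m u (fun j' => (b j' : ℝ)) w j⌋) :
          (Fin n → Fin W → ℤ) × (Fin W → ℤ))) ''
        {u | ∀ w < W, ∀ j, u w j ∈ Set.Icc (0 : ℝ) 1}) ≤
      ∏ w ∈ Finset.range W,
        ((2 ^ (w + 1) * ∑ j, (b j).natAbs + 1) *
          ∏ i, (2 ^ (w + 1) * ∑ j, (A j i).natAbs + 1)) := by
  let I (c : Fin m → ℤ) (w : ℕ) : Finset ℤ :=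
    Finset.Icc (-((2 ^ w * ∑ j, (c j).natAbs : ℕ) : ℤ)) ((2 ^ w * ∑ j, (c j).natAbs : ℕ) : ℤ)
  have hI (c : Fin m → ℤ) (w : ℕ) : (I c w).card = 2 ^ (w + 1) * ∑ j, (c j).natAbs + 1 := by
    rw [card_Icc_neg_natCast, pow_succ]
    ring
  let S : Finset ((Fin n → Fin W → ℤ) × (Fin W → ℤ)) :=
    (Fintype.piFinset fun i => Fintype.piFinset fun w : Fin W => I (fun j => A j i) w) ×ˢ
      Fintype.piFinset fun w : Fin W => I b w
  have hS : S.card = ∏ w ∈ Finset.range W,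
      ((2 ^ (w + 1) * ∑ j, (b j).natAbs + 1) *
        ∏ i, (2 ^ (w + 1) * ∑ j, (A j i).natAbs + 1)) := by
    simp only [S, Finset.card_product, Fintype.card_piFinset, hI]
    rw [Finset.prod_comm, mul_comm, ← Finset.prod_mul_distrib, Finset.prod_range]
  rw [← hS, Nat.card_coe_set_eq, ← Set.ncard_coe_finset]
  refine (fun h => ⟨S.finite_toSet.subset h, Set.ncard_le_ncard h S.finite_toSet⟩) ?_
  rintro _ ⟨u, hu, rfl⟩
  have hmem (c : Fin m → ℤ) (w : Fin W) :=
    floor_sum_mul_atil_mem_Icc m u c w fun k hk => hu k (hk.trans_lt w.isLt)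
  simp only [S, Finset.coe_product, Set.mem_prod, Finset.mem_coe, Fintype.mem_piFinset]
  exact ⟨fun i w => hmem (fun j => A j i) w, fun w => hmem b w⟩
end

section
/- Consider the abstract tree search algorithm run for κ rounds of t steps each. For every action sequence σ ∈ ([T_1] × ⋯ × [T_t])^κ, there exists a collection of at most κ·∑_{j=1}^t T_j² open halfspaces through the origin in ℝ^d (sets of the form {μ ∈ ℝ^d : w·μ > 0} for some w ∈ ℝ^d) whose intersection is exactly the set of parameter vectors μ ∈ ℝ^d that follow σ. Consequently, all parameter vectors in one cell of the induced arrangement make the algorithm take the same sequence of actions and reach the same final state. -/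
/-- The state of abstract tree search within a round: starting from state `s`,
execute the actions `act j` of steps `0, …, j₀ − 1` via the deterministic
transitions `g`. -/
def withinRound {S : Type} {t : ℕ} {T : Fin t → ℕ}
    (g : (j : Fin t) → Fin (T j) → S → S)
    (act : (j : Fin t) → Fin (T j)) (s : S) : ℕ → S
  | 0 => s
  | (j + 1) =>
      if h : j < t then g ⟨j, h⟩ (act ⟨j, h⟩) (withinRound g act s j)
      else withinRound g act s j

/-- The state of abstract tree search at the start of round `i`, obtained by
executing the action sequence `σ` from the initial state `s₀`. -/
def roundState {S : Type} {κ t : ℕ} {T : Fin t → ℕ}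
    (g : (j : Fin t) → Fin (T j) → S → S) (s₀ : S)
    (σ : Fin κ → (j : Fin t) → Fin (T j)) : ℕ → S
  | 0 => s₀
  | (i + 1) =>
      if h : i < κ then withinRound g (σ ⟨i, h⟩) (roundState g s₀ σ i) t
      else roundState g s₀ σ i

/-- `μ` follows the action sequence `σ`: at every step `j` of every round `i`,
the action `σ i j` strictly maximizes the `μ_j`-weighted sum of the scoring
rules evaluated at the state `s_{i,j}(σ)` reached by executing `σ`. -/
def Follows {S : Type} {κ t : ℕ} {T : Fin t → ℕ} {d : Fin t → ℕ}
    (score : (j : Fin t) → Fin (d j) → Fin (T j) → S → ℝ)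
    (g : (j : Fin t) → Fin (T j) → S → S) (s₀ : S)
    (σ : Fin κ → (j : Fin t) → Fin (T j))
    (μ : (j : Fin t) → Fin (d j) → ℝ) : Prop :=
  ∀ (i : Fin κ) (j : Fin t) (k : Fin (T j)), k ≠ σ i j →
    ∑ i', μ j i' * score j i' k (withinRound g (σ i) (roundState g s₀ σ i) j) <
      ∑ i', μ j i' * score j i' (σ i j) (withinRound g (σ i) (roundState g s₀ σ i) j)

/-- **Halfspace description of the parameters following a fixed action
sequence.** For every action sequence `σ ∈ ([T_1] × ⋯ × [T_t])^κ` there is a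
collection of at most `κ ⬝ ∑_j T_j²` open halfspaces through the origin in
`ℝ^d` (`d = ∑_j d_j`), given by their normal vectors, whose intersection is
exactly the set of parameter vectors `μ` that follow `σ`. Consequently, all
parameters in one cell of the induced arrangement take the same sequence of
actions and reach the same final state. -/
theorem tree_search_halfspace_partition {S : Type} (κ t : ℕ) (T : Fin t → ℕ)
    (d : Fin t → ℕ)
    (score : (j : Fin t) → Fin (d j) → Fin (T j) → S → ℝ)
    (g : (j : Fin t) → Fin (T j) → S → S) (s₀ : S)
    (σ : Fin κ → (j : Fin t) → Fin (T j)) :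
    ∃ H : Finset ((j : Fin t) → Fin (d j) → ℝ),
      H.card ≤ κ * ∑ j, (T j) ^ 2 ∧
      {μ : (j : Fin t) → Fin (d j) → ℝ | Follows score g s₀ σ μ} =
        {μ : (j : Fin t) → Fin (d j) → ℝ |
          ∀ w ∈ H, 0 < ∑ j, ∑ i, w j i * μ j i} := by
  classical
  let normal : Fin κ × (Σ j, Fin (T j)) → (j : Fin t) → Fin (d j) → ℝ := fun p =>
    Pi.single p.2.1 fun i' =>
      score p.2.1 i' (σ p.1 p.2.1)
          (withinRound g (σ p.1) (roundState g s₀ σ p.1) p.2.1) -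
        score p.2.1 i' p.2.2 (withinRound g (σ p.1) (roundState g s₀ σ p.1) p.2.1)
  refine ⟨(Finset.univ.filter fun p => p.2.2 ≠ σ p.1 p.2.1).image normal, ?_, ?_⟩
  · calc _ ≤ (Finset.univ : Finset (Fin κ × (Σ j, Fin (T j)))).card :=
          Finset.card_image_le.trans (Finset.card_filter_le _ _)
      _ = κ * ∑ j, T j := by simp
      _ ≤ κ * ∑ j, (T j) ^ 2 := by
          gcongr with j
          exact Nat.le_self_pow two_ne_zero _
  · have key : ∀ (p : Fin κ × (Σ j, Fin (T j))) (μ : (j : Fin t) → Fin (d j) → ℝ),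
        ∑ j, ∑ i, normal p j i * μ j i =
          ∑ i', μ p.2.1 i' * score p.2.1 i' (σ p.1 p.2.1)
              (withinRound g (σ p.1) (roundState g s₀ σ p.1) p.2.1) -
            ∑ i', μ p.2.1 i' * score p.2.1 i' p.2.2
              (withinRound g (σ p.1) (roundState g s₀ σ p.1) p.2.1) := by
      intro p μ
      rw [Finset.sum_eq_single p.2.1 (fun j _ hj => by simp [normal, Pi.single_eq_of_ne hj])
        (by simp), ← Finset.sum_sub_distrib]
      refine Finset.sum_congr rfl fun i _ => ?_
      simp only [normal, Pi.single_eq_same]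
      ring
    ext μ
    simp only [Set.mem_ofPred_eq, Finset.forall_mem_image, Finset.mem_filter, Finset.mem_univ,
      true_and, key, sub_pos]
    exact ⟨fun h p hp => h p.1 p.2.1 p.2.2 hp, fun h i j k hk => h (x := (i, ⟨j, k⟩)) hk⟩
end
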